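/- The promotion map is a well-defined bijection of B^{m,i}: for every A ∈ B^{m,i} the array pr(A) produced by the promotion algorithm again satisfies all Dyck path inequalities, so pr(A) ∈ B^{m,i}, and the resulting map pr : B^{m,i} → B^{m,i} is bijective. -/

import Mathlib

open Finset

namespace KR

/-- Arrays of integers indexed by (column, row). -/
abbrev Arr := ℕ → ℕ → ℤ

/-- A Dyck path from (1,i) to (i,n). -/
def IsDyck (n i : ℕ) (L : List (ℕ × ℕ)) : Prop :=
  L ≠ [] ∧ L.head? = some (1, i) ∧ L.getLast? = some (i, n) ∧
    L.Chain' (fun β γ => γ = (β.1, β.2 + 1) ∨ γ = (β.1 + 1, β.2))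

/-- Membership in the polytope `B^{m,i}`: nonnegative entries supported on the box
`1 ≤ p ≤ i`, `i ≤ q ≤ n`, with all Dyck path sums bounded by `m`. -/
def InB (n i m : ℕ) (A : Arr) : Prop :=
  (∀ p q, 1 ≤ p → p ≤ i → i ≤ q → q ≤ n → 0 ≤ A p q) ∧
  (∀ p q, ¬(1 ≤ p ∧ p ≤ i ∧ i ≤ q ∧ q ≤ n) → A p q = 0) ∧
  (∀ L, IsDyck n i L → (L.map fun β => A β.1 β.2).sum ≤ (m : ℤ))

/-- The sum `Σ_{j=1}^{p} a_{j,l−1} + Σ_{j=p}^{i} a_{j,l}` (used for `l > i`). -/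
def Fp (i : ℕ) (A : Arr) (l p : ℕ) : ℤ :=
  ∑ j ∈ Icc 1 p, A j (l - 1) + ∑ j ∈ Icc p i, A j l

/-- `p_+^l(A)`: minimal maximizer of `Fp` on `{1,…,i}`. -/
noncomputable def pplus (i : ℕ) (A : Arr) (l : ℕ) : ℕ :=
  sInf {p | p ∈ Icc 1 i ∧ ∀ q ∈ Icc 1 i, Fp i A l q ≤ Fp i A l p}

/-- `q_+^l(A)`: maximal maximizer of `Fp` on `{1,…,i}`. -/
noncomputable def qplus (i : ℕ) (A : Arr) (l : ℕ) : ℕ :=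
  sSup {p | p ∈ Icc 1 i ∧ ∀ q ∈ Icc 1 i, Fp i A l q ≤ Fp i A l p}

/-- The sum `Σ_{j=i}^{p} a_{l,j} + Σ_{j=p}^{n} a_{l+1,j}` (used for `l < i`). -/
def Fm (n i : ℕ) (A : Arr) (l p : ℕ) : ℤ :=
  ∑ j ∈ Icc i p, A l j + ∑ j ∈ Icc p n, A (l + 1) j

/-- `p_−^l(A)`: maximal maximizer of `Fm` on `{i,…,n}`. -/
noncomputable def pminus (n i : ℕ) (A : Arr) (l : ℕ) : ℕ :=
  sSup {p | p ∈ Icc i n ∧ ∀ q ∈ Icc i n, Fm n i A l q ≤ Fm n i A l p}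

/-- `q_−^l(A)`: minimal maximizer of `Fm` on `{i,…,n}`. -/
noncomputable def qminus (n i : ℕ) (A : Arr) (l : ℕ) : ℕ :=
  sInf {p | p ∈ Icc i n ∧ ∀ q ∈ Icc i n, Fm n i A l q ≤ Fm n i A l p}

/-- `φ_l(A)` (depending on the parameter `m` only when `l = i`). -/
noncomputable def phi (n i m : ℕ) (l : ℕ) (A : Arr) : ℤ :=
  if l = i then (m : ℤ) - ∑ j ∈ Icc 1 (i - 1), A j i - ∑ j ∈ Icc i n, A i j
  else if i < l then
    ∑ j ∈ Icc 1 (pplus i A l), A j (l - 1) - ∑ j ∈ Icc 1 (pplus i A l - 1), A j l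
  else
    ∑ j ∈ Icc (pminus n i A l) n, A (l + 1) j - ∑ j ∈ Icc (pminus n i A l + 1) n, A l j

/-- `ε_l(A)` (the parameter `m` is carried along for uniformity; it is not used). -/
noncomputable def eps (n i m : ℕ) (l : ℕ) (A : Arr) : ℤ :=
  if l = i then A i i
  else if i < l then
    ∑ j ∈ Icc (qplus i A l) i, A j l - ∑ j ∈ Icc (qplus i A l + 1) i, A j (l - 1)
  else
    ∑ j ∈ Icc i (qminus n i A l), A l j - ∑ j ∈ Icc i (qminus n i A l - 1), A (l + 1) j

/-- Update a single entry of an array. -/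
def upd (A : Arr) (p q : ℕ) (v : ℤ) : Arr :=
  fun p' q' => if p' = p ∧ q' = q then v else A p' q'

/-- The Kashiwara operator `f_l` (with `none` playing the role of `0`). -/
noncomputable def fop (n i m : ℕ) (l : ℕ) (A : Arr) : Option Arr :=
  if phi n i m l A = 0 then none
  else some <|
    if l = i then upd A i i (A i i + 1)
    else if i < l then
      upd (upd A (pplus i A l) (l - 1) (A (pplus i A l) (l - 1) - 1))
        (pplus i A l) l (A (pplus i A l) l + 1)
    else
      upd (upd A l (pminus n i A l) (A l (pminus n i A l) + 1))
        (l + 1) (pminus n i A l) (A (l + 1) (pminus n i A l) - 1)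

/-- The Kashiwara operator `e_l` (with `none` playing the role of `0`). -/
noncomputable def eop (n i m : ℕ) (l : ℕ) (A : Arr) : Option Arr :=
  if eps n i m l A = 0 then none
  else some <|
    if l = i then upd A i i (A i i - 1)
    else if i < l then
      upd (upd A (qplus i A l) (l - 1) (A (qplus i A l) (l - 1) + 1))
        (qplus i A l) l (A (qplus i A l) l - 1)
    else
      upd (upd A l (qminus n i A l) (A l (qminus n i A l) - 1))
        (l + 1) (qminus n i A l) (A (l + 1) (qminus n i A l) + 1)

/-- Coefficient of `ω_j` in the simple root `α_r` (column `r` of the Cartan matrix). -/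
def cart (j r : ℕ) : ℤ :=
  if r = j then 2 else if r = j + 1 ∨ j = r + 1 then -1 else 0

/-- The weight `wt(A) = mω_i − Σ a_{p,q} α_{p,q}`, expressed in the basis of
fundamental weights: `wtv n i m A j` is the coefficient of `ω_j`. -/
def wtv (n i m : ℕ) (A : Arr) (j : ℕ) : ℤ :=
  (m : ℤ) * (if j = i then 1 else 0) -
    ∑ p ∈ Icc 1 i, ∑ q ∈ Icc i n, A p q * ∑ r ∈ Icc p q, cart j r

/-- The coefficient `c_l(p,q)` of the pairing `⟨α_l^∨, α_{p,q}⟩`. -/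
def clpq (l p q : ℕ) : ℤ :=
  if p = l ∧ q = l then 2
  else if (l = p ∧ p < q) ∨ (p < q ∧ q = l) then 1
  else if l + 1 = p ∨ l = q + 1 then -1
  else 0

/-- The pairing `⟨α_l^∨, wt(A)⟩ = m·δ_{l,i} − Σ_{p,q} a_{p,q}·c_l(p,q)`. -/
def pairing (n i m : ℕ) (l : ℕ) (A : Arr) : ℤ :=
  (m : ℤ) * (if l = i then 1 else 0) -
    ∑ p ∈ Icc 1 i, ∑ q ∈ Icc i n, A p q * clpq l p q

/-! ### The promotion algorithm -/

/-- Columns, indexed by rows `i,…,n`. -/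
abbrev Col := ℕ → ℤ

/-- `Σ_{j=lo}^{p} a_j + Σ_{j=p}^{n} b_j`. -/
def Gc (n lo : ℕ) (a b : Col) (p : ℕ) : ℤ := ∑ j ∈ Icc lo p, a j + ∑ j ∈ Icc p n, b j

/-- `q_−` for two (truncated) columns with rows `lo,…,n`: the minimal maximizer of `Gc`. -/
noncomputable def qmc (n lo : ℕ) (a b : Col) : ℕ :=
  if lo ≤ n then
    max lo (sInf {p | p ∈ Icc lo n ∧ ∀ q ∈ Icc lo n, Gc n lo a b q ≤ Gc n lo a b p})
  else n

/-- `ε` for two (truncated) columns with rows `lo,…,n`. -/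
noncomputable def epsc (n lo : ℕ) (a b : Col) : ℤ :=
  ∑ j ∈ Icc lo (qmc n lo a b), a j - ∑ j ∈ Icc lo (qmc n lo a b - 1), b j

/-- The sequence `l_1 < l_2 < ⋯` of the promotion algorithm:
`l_1 = q_−(a,c)` and `l_{s+1} = q_−((a)^{≥ l_s + 1}, (c)^{≥ l_s + 1})`,
stabilizing at `n`. -/
noncomputable def lfun (n i : ℕ) (a c : Col) : ℕ → ℕ
  | 0 => qmc n i a c
  | s + 1 => qmc n (lfun n i a c s + 1) a c

/-- The set `{l_1, …, l_t}` (with `l_t = n`). -/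
noncomputable def lset (n i : ℕ) (a c : Col) : Finset ℕ := (Finset.range (n + 1)).image (lfun n i a c)

/-- The new column `ĉ` of formula (6.2). -/
noncomputable def hatc (n i : ℕ) (a c : Col) : Col := fun r =>
  if r = n then a n + c n
  else if r ∈ lset n i a c then a r + c r - epsc n (r + 1) a c
  else a r

/-- The output column of one step of the promotion algorithm. -/
noncomputable def prcol (n i : ℕ) (a c : Col) : Col := fun r =>
  if r = i then epsc n i a c
  else if r - 1 ∈ lset n i a c then epsc n r a c
  else c (r - 1)

/-- The running columns of the promotion algorithm: `cseq 0` is the `i`-th column of `A`,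
and `cseq (k+1)` is obtained from the `(i−1−k)`-th column of `A` and `cseq k`. -/
noncomputable def cseq (n i : ℕ) (A : Arr) : ℕ → Col
  | 0 => fun r => A i r
  | k + 1 => hatc n i (fun r => A (i - 1 - k) r) (cseq n i A k)

/-- The `j`-th column of `pr(A)` for `2 ≤ j ≤ i`. -/
noncomputable def prColJ (n i : ℕ) (A : Arr) (j : ℕ) : Col :=
  prcol n i (fun q => A (j - 1) q) (cseq n i A (i - j))

/-- The promotion map `pr` on `B^{m,i}`. -/
noncomputable def prMap (n i m : ℕ) (A : Arr) : Arr := fun p r =>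
  if 1 ≤ p ∧ p ≤ i ∧ i ≤ r ∧ r ≤ n then
    if p = 1 then
      if r = i then
        (m : ℤ) - (∑ j ∈ Icc i n, A i j) - ∑ j ∈ Icc 2 i, prColJ n i A j i
      else
        (∑ j ∈ Icc 1 i, A j (r - 1)) - ∑ j ∈ Icc 2 i, prColJ n i A j r
    else prColJ n i A p r
  else 0

/-- The content `(r_1,…,r_{n+1})` of an array. -/
def cont (n i m : ℕ) (A : Arr) (k : ℕ) : ℤ :=
  if k ≤ i then (m : ℤ) - ∑ q ∈ Icc i n, A k q else ∑ p ∈ Icc 1 i, A p (k - 1)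

/-- `ε` plus the total of the second column: the last-passage value of the two columns. -/
noncomputable def lpp (n : ℕ) (a c : Col) (lo : ℕ) : ℤ := ∑ j ∈ Icc lo n, c j + epsc n lo a c

lemma Icc_sum_head {lo p : ℕ} (h : lo ≤ p) (f : ℕ → ℤ) :
    ∑ j ∈ Icc lo p, f j = f lo + ∑ j ∈ Icc (lo + 1) p, f j := by
  have e : Icc (lo + 1) p = Ioc lo p := by ext; simp
  rw [e, add_sum_Ioc_eq_sum_Icc h]

lemma qmc_spec {n lo : ℕ} (h : lo ≤ n) (a c : Col) :
    lo ≤ qmc n lo a c ∧ qmc n lo a c ≤ n ∧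
      (∀ q, lo ≤ q → q ≤ n → Gc n lo a c q ≤ Gc n lo a c (qmc n lo a c)) ∧
      ∀ q, lo ≤ q → q < qmc n lo a c → Gc n lo a c q < Gc n lo a c (qmc n lo a c) := by
  set S : Set ℕ := {p | p ∈ Icc lo n ∧ ∀ q ∈ Icc lo n, Gc n lo a c q ≤ Gc n lo a c p}
  have hne : S.Nonempty := by
    obtain ⟨p, hp, hm⟩ := (Icc lo n).exists_max_image (Gc n lo a c) ⟨lo, by simp [h]⟩
    exact ⟨p, hp, hm⟩
  have hmem := Nat.sInf_mem hne
  have hq : qmc n lo a c = sInf S := by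
    have := (mem_Icc.1 hmem.1).1
    rw [qmc, if_pos h]
    exact max_eq_right this
  rw [hq]
  have h1 := mem_Icc.1 hmem.1
  refine ⟨h1.1, h1.2, fun q h2 h3 => hmem.2 q (mem_Icc.2 ⟨h2, h3⟩), fun q h2 h3 => ?_⟩
  by_contra! hlt
  exact Nat.notMem_of_lt_sInf h3
    ⟨mem_Icc.2 ⟨h2, h3.le.trans h1.2⟩, fun q' hq' => (hmem.2 q' hq').trans hlt⟩

lemma qmc_unique {n lo p : ℕ} {a c : Col} (h1 : lo ≤ p) (h2 : p ≤ n)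
    (h3 : ∀ q, lo ≤ q → q ≤ n → Gc n lo a c q ≤ Gc n lo a c p)
    (h4 : ∀ q, lo ≤ q → q < p → Gc n lo a c q < Gc n lo a c p) : qmc n lo a c = p := by
  obtain ⟨s1, s2, s3, s4⟩ := qmc_spec (h1.trans h2) a c
  rcases lt_trichotomy (qmc n lo a c) p with h | h | h
  · exact absurd (s3 p h1 h2) (not_le.2 (h4 _ s1 h))
  · exact h
  · exact absurd (h3 _ s1 s2) (not_le.2 (s4 _ h1 h))

lemma Gc_self {n lo : ℕ} (a c : Col) : Gc n lo a c lo = a lo + ∑ j ∈ Icc lo n, c j := by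
  simp [Gc]

lemma Gc_succ {n lo p : ℕ} (h : lo < p) (a c : Col) :
    Gc n lo a c p = a lo + Gc n (lo + 1) a c p := by
  rw [Gc, Gc, Icc_sum_head h.le, add_assoc]

lemma lpp_eq {n lo : ℕ} (h0 : 1 ≤ lo) (h : lo ≤ n) (a c : Col) :
    lpp n a c lo = Gc n lo a c (qmc n lo a c) := by
  obtain ⟨s1, s2, -, -⟩ := qmc_spec h a c
  rw [lpp, epsc, Gc]
  generalize qmc n lo a c = q at s1 s2
  have : ∑ j ∈ Icc lo n, c j = ∑ j ∈ Icc lo (q - 1), c j + ∑ j ∈ Icc q n, c j := by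
    have e : ∀ x y, Icc x y = Ico x (y + 1) := fun x y => by ext; simp
    rw [e, e, e, Nat.sub_add_cancel (h0.trans s1), sum_Ico_consecutive _ s1 (by omega)]
  rw [this]
  ring

lemma qmc_self {n : ℕ} (a c : Col) : qmc n n a c = n := by
  obtain ⟨s1, s2, -, -⟩ := qmc_spec (le_refl n) a c
  omega

lemma qmc_of_lt {n lo : ℕ} (h : n < lo) (a c : Col) : qmc n lo a c = n := by
  rw [qmc, if_neg (by omega)]

lemma lpp_end (n : ℕ) (a c : Col) : lpp n a c (n + 1) = 0 := by
  rw [lpp, epsc, qmc_of_lt (Nat.lt_succ_self n), Icc_eq_empty (by omega), Icc_eq_empty (by omega)]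
  simp

lemma qmc_step_le {n lo : ℕ} (h0 : 1 ≤ lo) (h : lo < n) {a c : Col}
    (hle : lpp n a c (lo + 1) ≤ ∑ j ∈ Icc lo n, c j) : qmc n lo a c = lo := by
  obtain ⟨s1, s2, s3, -⟩ := qmc_spec (show lo + 1 ≤ n from h) a c
  rw [lpp_eq (by omega) h] at hle
  refine qmc_unique le_rfl h.le (fun q h1 h2 => ?_) (fun q h1 h2 => by omega)
  rcases h1.eq_or_lt with rfl | h1
  · rfl
  · rw [Gc_succ h1, Gc_self]
    linarith [s3 q h1 h2]

lemma qmc_step_lt {n lo : ℕ} (h : lo < n) {a c : Col}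
    (hlt : ∑ j ∈ Icc lo n, c j < lpp n a c (lo + 1)) :
    qmc n lo a c = qmc n (lo + 1) a c := by
  obtain ⟨s1, s2, s3, s4⟩ := qmc_spec (show lo + 1 ≤ n from h) a c
  rw [lpp_eq (by omega) h] at hlt
  refine qmc_unique (by omega) s2 (fun q h1 h2 => ?_) (fun q h1 h2 => ?_)
  all_goals
    rw [Gc_succ (lo := lo) (p := qmc n (lo + 1) a c) s1]
    rcases h1.eq_or_lt with rfl | h1
    · rw [Gc_self]; linarith
    · rw [Gc_succ h1]
      first
        | linarith [s3 q h1 h2]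
        | linarith [s4 q h1 h2]

lemma qmc_eq_self_iff {n lo : ℕ} (h0 : 1 ≤ lo) (h : lo < n) {a c : Col} :
    qmc n lo a c = lo ↔ lpp n a c (lo + 1) ≤ ∑ j ∈ Icc lo n, c j := by
  refine ⟨fun hq => ?_, qmc_step_le h0 h⟩
  by_contra! hlt
  have := (qmc_spec (show lo + 1 ≤ n from h) a c).1
  rw [← qmc_step_lt h hlt] at this
  omega

lemma lpp_step {n lo : ℕ} (h0 : 1 ≤ lo) (h : lo ≤ n) (a : Col) {c : Col} (hc : 0 ≤ c n) :
    lpp n a c lo = a lo + max (lpp n a c (lo + 1)) (∑ j ∈ Icc lo n, c j) := by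
  rcases h.eq_or_lt with rfl | h
  · rw [lpp_end, lpp_eq h0 le_rfl, qmc_self, Gc_self, max_eq_right]
    simpa using hc
  · rw [lpp_eq h0 h.le]
    rcases le_or_gt (lpp n a c (lo + 1)) (∑ j ∈ Icc lo n, c j) with hle | hlt
    · rw [qmc_step_le h0 h hle, max_eq_right hle, Gc_self]
    · rw [max_eq_left hlt.le, qmc_step_lt h hlt, lpp_eq (by omega) h,
        Gc_succ (qmc_spec (show lo + 1 ≤ n from h) a c).1]

lemma qmc_idem {n : ℕ} (a c : Col) {lo : ℕ} (h0 : 1 ≤ lo) :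
    qmc n (qmc n lo a c) a c = qmc n lo a c := by
  rcases le_or_gt n lo with h | h
  · have : qmc n lo a c = n := by
      rcases h.eq_or_lt with rfl | h
      · exact qmc_self a c
      · exact qmc_of_lt h a c
    rw [this, qmc_self]
  · rcases le_or_gt (lpp n a c (lo + 1)) (∑ j ∈ Icc lo n, c j) with hle | hlt
    · rw [qmc_step_le h0 h hle, qmc_step_le h0 h hle]
    · rw [qmc_step_lt h hlt]
      exact qmc_idem a c (by omega)
termination_by n - lo

lemma qmc_le_of_fixed {n r : ℕ} {a c : Col} (hr : r < n) (hq : qmc n r a c = r) {lo : ℕ}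
    (h0 : 1 ≤ lo) (h : lo ≤ r) : qmc n lo a c ≤ r := by
  rcases h.eq_or_lt with rfl | h
  · exact hq.le
  · rcases le_or_gt (lpp n a c (lo + 1)) (∑ j ∈ Icc lo n, c j) with hle | hlt
    · rw [qmc_step_le h0 (by omega) hle]; omega
    · rw [qmc_step_lt (by omega) hlt]
      exact qmc_le_of_fixed hr hq (by omega) h
termination_by r - lo

lemma mem_lset_iff {n i r : ℕ} (hi : 1 ≤ i) (hr : i ≤ r) (hrn : r < n) {a c : Col} :
    r ∈ lset n i a c ↔ lpp n a c (r + 1) ≤ ∑ j ∈ Icc r n, c j := by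
  rw [← qmc_eq_self_iff (hi.trans hr) hrn, lset, mem_image]
  constructor
  · rintro ⟨s, -, rfl⟩
    cases s with
    | zero => exact qmc_idem a c hi
    | succ s => exact qmc_idem a c (Nat.succ_pos _)
  · intro hq
    by_contra! hne
    have key : ∀ s ≤ n, s ≤ lfun n i a c s ∧ lfun n i a c s < r := by
      intro s
      induction s with
      | zero =>
        intro hs
        exact ⟨Nat.zero_le _,
          lt_of_le_of_ne (qmc_le_of_fixed hrn hq hi hr) (hne 0 (by simp))⟩
      | succ s ih =>
        intro hs
        obtain ⟨h1, h2⟩ := ih (by omega)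
        have h3 := (qmc_spec (show lfun n i a c s + 1 ≤ n by omega) a c).1
        exact ⟨le_trans (by omega) h3,
          lt_of_le_of_ne (qmc_le_of_fixed hrn hq (Nat.succ_pos _) h2)
            (hne (s + 1) (by simp; omega))⟩
    have := key n le_rfl
    omega

lemma hatc_eq {n i r : ℕ} (hi : 1 ≤ i) (hr : i ≤ r) (hrn : r ≤ n) (a : Col) {c : Col}
    (hc : 0 ≤ c n) : hatc n i a c r = lpp n a c r - lpp n a c (r + 1) := by
  rw [lpp_step (hi.trans hr) hrn a hc, hatc]
  rcases hrn.eq_or_lt with rfl | hrn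
  · simp [lpp_end, hc]
  · have hS := Icc_sum_head hrn.le c
    have hE : lpp n a c (r + 1) = ∑ j ∈ Icc (r + 1) n, c j + epsc n (r + 1) a c := rfl
    rw [if_neg hrn.ne]
    split_ifs with h
    · rw [mem_lset_iff hi hr hrn] at h
      rw [max_eq_right h]
      linarith
    · rw [mem_lset_iff hi hr hrn, not_le] at h
      rw [max_eq_left h.le]
      ring

lemma sum_hatc {n i : ℕ} (hi : 1 ≤ i) (a : Col) {c : Col} (hc : 0 ≤ c n) {r : ℕ} (hr : i ≤ r)
    (hrn : r ≤ n + 1) : ∑ j ∈ Icc r n, hatc n i a c j = lpp n a c r := by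
  rcases hrn.eq_or_lt with rfl | h
  · rw [lpp_end, Icc_eq_empty (by omega), sum_empty]
  · rw [Icc_sum_head (Nat.lt_succ_iff.1 h), sum_hatc hi a hc (by omega) (by omega),
      hatc_eq hi hr (by omega) a hc]
    ring
termination_by n + 1 - r

lemma prcol_top (n i : ℕ) (a c : Col) :
    prcol n i a c i = lpp n a c i - ∑ j ∈ Icc i n, c j := by
  simp [prcol, lpp]

lemma prcol_succ {n i r : ℕ} (hi : 1 ≤ i) (hr : i ≤ r) (hrn : r < n) (a c : Col) :
    prcol n i a c (r + 1) =
      min (lpp n a c (r + 1)) (∑ j ∈ Icc r n, c j) - ∑ j ∈ Icc (r + 1) n, c j := by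
  have hS := Icc_sum_head hrn.le c
  have hE : lpp n a c (r + 1) = ∑ j ∈ Icc (r + 1) n, c j + epsc n (r + 1) a c := rfl
  rw [prcol, if_neg (by omega), Nat.add_sub_cancel]
  split_ifs with h
  · rw [mem_lset_iff hi hr hrn] at h
    rw [min_eq_left h]
    linarith
  · rw [mem_lset_iff hi hr hrn, not_le] at h
    rw [min_eq_right h.le]
    linarith

/-- The maximal weight of a path from `(p, r)` to `(i, n)`, read off the running columns. -/
noncomputable def passage (n i : ℕ) (A : Arr) (p r : ℕ) : ℤ :=
  ∑ j ∈ Icc r n, cseq n i A (i - p) j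

section passage

variable {n i : ℕ} {A : Arr}

lemma passage_end (p : ℕ) : passage n i A p (n + 1) = 0 := by
  rw [passage, Icc_eq_empty (by omega), sum_empty]

lemma cseq_nonneg (hi : 1 ≤ i) (h : ∀ p q, 1 ≤ p → p ≤ i → i ≤ q → q ≤ n → 0 ≤ A p q)
    (k : ℕ) (hk : k < i) (r : ℕ) (hr : i ≤ r) (hrn : r ≤ n) : 0 ≤ cseq n i A k r := by
  induction k generalizing r with
  | zero => exact h i r hi le_rfl hr hrn
  | succ k ih =>
    have hc := ih (by omega) n (hr.trans hrn) le_rfl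
    rw [cseq, hatc_eq hi hr hrn _ hc, lpp_step (hi.trans hr) hrn _ hc]
    have h1 := h (i - 1 - k) r (by omega) (by omega) hr hrn
    linarith [le_max_left (lpp n (fun r => A (i - 1 - k) r) (cseq n i A k) (r + 1))
      (∑ j ∈ Icc r n, cseq n i A k j)]

lemma passage_nonneg (hi : 1 ≤ i) (h : ∀ p q, 1 ≤ p → p ≤ i → i ≤ q → q ≤ n → 0 ≤ A p q)
    {p r : ℕ} (hp : 1 ≤ p) (hr : i ≤ r) : 0 ≤ passage n i A p r := by
  refine sum_nonneg fun j hj => ?_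
  rw [mem_Icc] at hj
  exact cseq_nonneg hi h _ (by omega) j (by omega) hj.2

lemma passage_eq_lpp (hi : 1 ≤ i) (h : ∀ p q, 1 ≤ p → p ≤ i → i ≤ q → q ≤ n → 0 ≤ A p q)
    {p r : ℕ} (hp : 1 ≤ p) (hpi : p < i) (hr : i ≤ r) (hrn : r ≤ n + 1) (hin : i ≤ n) :
    passage n i A p r = lpp n (fun q => A p q) (cseq n i A (i - (p + 1))) r := by
  have e : i - p = i - (p + 1) + 1 := by omega
  have e' : i - 1 - (i - (p + 1)) = p := by omega
  rw [passage, e, cseq, e',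
    sum_hatc hi _ (cseq_nonneg hi h _ (by omega) n hin le_rfl) hr hrn]

lemma passage_last {r : ℕ} (hrn : r ≤ n) :
    passage n i A i r = A i r + passage n i A i (r + 1) := by
  simp only [passage, Nat.sub_self, cseq]
  exact Icc_sum_head hrn _

lemma passage_step (hi : 1 ≤ i) (h : ∀ p q, 1 ≤ p → p ≤ i → i ≤ q → q ≤ n → 0 ≤ A p q)
    {p r : ℕ} (hp : 1 ≤ p) (hpi : p < i) (hr : i ≤ r) (hrn : r ≤ n) :
    passage n i A p r =
      A p r + max (passage n i A p (r + 1)) (passage n i A (p + 1) r) := by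
  rw [passage_eq_lpp hi h hp hpi hr (by omega) (hr.trans hrn),
    lpp_step (hi.trans hr) hrn _ (cseq_nonneg hi h _ (by omega) n (hr.trans hrn) le_rfl),
    passage_eq_lpp hi h hp hpi (r := r + 1) (by omega) (by omega) (hr.trans hrn)]
  rfl

lemma prColJ_top (hi : 1 ≤ i) (h : ∀ p q, 1 ≤ p → p ≤ i → i ≤ q → q ≤ n → 0 ≤ A p q)
    (hin : i ≤ n) {p : ℕ} (hp : 1 ≤ p) (hpi : p < i) :
    prColJ n i A (p + 1) i = passage n i A p i - passage n i A (p + 1) i := by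
  rw [prColJ, prcol_top, passage_eq_lpp hi h hp hpi le_rfl (by omega) hin]
  rfl

lemma prColJ_succ (hi : 1 ≤ i) (h : ∀ p q, 1 ≤ p → p ≤ i → i ≤ q → q ≤ n → 0 ≤ A p q)
    {p r : ℕ} (hp : 1 ≤ p) (hpi : p < i) (hr : i ≤ r) (hrn : r < n) :
    prColJ n i A (p + 1) (r + 1) =
      min (passage n i A p (r + 1)) (passage n i A (p + 1) r) - passage n i A (p + 1) (r + 1) := by
  rw [prColJ, prcol_succ hi hr hrn,
    passage_eq_lpp hi h hp hpi (r := r + 1) (by omega) (by omega) (by omega)]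
  rfl

lemma sum_Icc_two_telescope (f : ℕ → ℤ) {k : ℕ} (hk : 1 ≤ k) :
    ∑ j ∈ Icc 2 k, (f (j - 1) - f j) = f 1 - f k := by
  induction k, hk using Nat.le_induction with
  | base => simp
  | succ k hk ih =>
    rw [sum_Icc_succ_top (by omega), ih]
    simp

lemma prMap_corner (m : ℕ) (hi : 1 ≤ i)
    (h : ∀ p q, 1 ≤ p → p ≤ i → i ≤ q → q ≤ n → 0 ≤ A p q) (hin : i ≤ n) :
    prMap n i m A 1 i = m - passage n i A 1 i := by
  have e : ∑ j ∈ Icc 2 i, prColJ n i A j i = passage n i A 1 i - passage n i A i i := by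
    rw [← sum_Icc_two_telescope (fun j => passage n i A j i) hi]
    refine sum_congr rfl fun j hj => ?_
    rw [mem_Icc] at hj
    obtain ⟨p, rfl⟩ : ∃ p, j = p + 1 := ⟨j - 1, by omega⟩
    exact prColJ_top hi h hin (by omega) (by omega)
  have e' : passage n i A i i = ∑ j ∈ Icc i n, A i j := by simp [passage, cseq]
  rw [prMap, if_pos ⟨le_rfl, hi, le_rfl, hin⟩, if_pos rfl, if_pos rfl, e, e']
  ring

lemma prMap_one_succ (m : ℕ) (hi : 1 ≤ i)
    (h : ∀ p q, 1 ≤ p → p ≤ i → i ≤ q → q ≤ n → 0 ≤ A p q) {r : ℕ} (hr : i ≤ r) (hrn : r < n) :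
    prMap n i m A 1 (r + 1) = passage n i A 1 r - passage n i A 1 (r + 1) := by
  have e0 : ∑ j ∈ Icc 1 i, A j r = A i r + ∑ j ∈ Icc 2 i, A (j - 1) r := by
    have : ∀ k, 1 ≤ k → ∑ j ∈ Icc 1 k, A j r = A k r + ∑ j ∈ Icc 2 k, A (j - 1) r := by
      intro k hk
      induction k, hk using Nat.le_induction with
      | base => simp
      | succ k hk ih =>
        rw [sum_Icc_succ_top (by omega), ih, sum_Icc_succ_top (by omega), Nat.add_sub_cancel]
        ring
    exact this i hi
  have e : ∑ j ∈ Icc 2 i, A (j - 1) r - ∑ j ∈ Icc 2 i, prColJ n i A j (r + 1) =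
      (passage n i A 1 r - passage n i A 1 (r + 1)) -
        (passage n i A i r - passage n i A i (r + 1)) := by
    rw [← sum_Icc_two_telescope (fun j => passage n i A j r - passage n i A j (r + 1)) hi,
      ← sum_sub_distrib]
    refine sum_congr rfl fun j hj => ?_
    rw [mem_Icc] at hj
    obtain ⟨p, rfl⟩ : ∃ p, j = p + 1 := ⟨j - 1, by omega⟩
    rw [prColJ_succ hi h (by omega) (by omega) hr hrn, Nat.add_sub_cancel]
    have h1 := passage_step hi h (p := p) (by omega) (by omega) hr hrn.le
    have h2 := max_add_min (passage n i A p (r + 1)) (passage n i A (p + 1) r)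
    linarith
  have e1 := passage_last (i := i) (A := A) hrn.le
  rw [prMap, if_pos ⟨le_rfl, hi, by omega, by omega⟩, if_pos rfl, if_neg (by omega),
    Nat.add_sub_cancel]
  linarith

lemma prMap_succ_top (m : ℕ) (hi : 1 ≤ i)
    (h : ∀ p q, 1 ≤ p → p ≤ i → i ≤ q → q ≤ n → 0 ≤ A p q) (hin : i ≤ n) {p : ℕ}
    (hp : 1 ≤ p) (hpi : p < i) :
    prMap n i m A (p + 1) i = passage n i A p i - passage n i A (p + 1) i := by
  rw [prMap, if_pos ⟨by omega, by omega, le_rfl, hin⟩, if_neg (by omega),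
    prColJ_top hi h hin hp hpi]

lemma prMap_succ_succ (m : ℕ) (hi : 1 ≤ i)
    (h : ∀ p q, 1 ≤ p → p ≤ i → i ≤ q → q ≤ n → 0 ≤ A p q) {p r : ℕ}
    (hp : 1 ≤ p) (hpi : p < i) (hr : i ≤ r) (hrn : r < n) :
    prMap n i m A (p + 1) (r + 1) =
      min (passage n i A p (r + 1)) (passage n i A (p + 1) r) - passage n i A (p + 1) (r + 1) := by
  rw [prMap, if_pos ⟨by omega, by omega, by omega, by omega⟩, if_neg (by omega),
    prColJ_succ hi h hp hpi hr hrn]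

lemma passage_le_down (hi : 1 ≤ i) (h : ∀ p q, 1 ≤ p → p ≤ i → i ≤ q → q ≤ n → 0 ≤ A p q)
    {p r : ℕ} (hp : 1 ≤ p) (hpi : p ≤ i) (hr : i ≤ r) (hrn : r ≤ n) :
    A p r + passage n i A p (r + 1) ≤ passage n i A p r := by
  rcases hpi.eq_or_lt with rfl | hpi
  · exact (passage_last hrn).ge
  · rw [passage_step hi h hp hpi hr hrn]
    gcongr
    exact le_max_left _ _

lemma passage_le_right (hi : 1 ≤ i) (h : ∀ p q, 1 ≤ p → p ≤ i → i ≤ q → q ≤ n → 0 ≤ A p q)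
    {p r : ℕ} (hp : 1 ≤ p) (hpi : p < i) (hr : i ≤ r) (hrn : r ≤ n) :
    A p r + passage n i A (p + 1) r ≤ passage n i A p r := by
  rw [passage_step hi h hp hpi hr hrn]
  gcongr
  exact le_max_right _ _

lemma prMap_add_passage_le_up (m : ℕ) (hi : 1 ≤ i)
    (h : ∀ p q, 1 ≤ p → p ≤ i → i ≤ q → q ≤ n → 0 ≤ A p q) {p r : ℕ}
    (hp : 1 ≤ p) (hpi : p ≤ i) (hr : i ≤ r) (hrn : r < n) :
    prMap n i m A p (r + 1) + passage n i A p (r + 1) ≤ passage n i A p r := by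
  rcases hp.eq_or_lt with rfl | hp
  · rw [prMap_one_succ m hi h hr hrn]; linarith
  · obtain ⟨p, rfl⟩ : ∃ k, p = k + 1 := ⟨p - 1, by omega⟩
    rw [prMap_succ_succ m hi h (by omega) (by omega) hr hrn]
    linarith [min_le_right (passage n i A p (r + 1)) (passage n i A (p + 1) r)]

lemma prMap_add_passage_le_left (m : ℕ) (hi : 1 ≤ i)
    (h : ∀ p q, 1 ≤ p → p ≤ i → i ≤ q → q ≤ n → 0 ≤ A p q) {p r : ℕ}
    (hp : 1 ≤ p) (hpi : p < i) (hr : i ≤ r) (hrn : r ≤ n) :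
    prMap n i m A (p + 1) r + passage n i A (p + 1) r ≤ passage n i A p r := by
  rcases hr.eq_or_lt with rfl | hr
  · rw [prMap_succ_top m hi h hrn hp hpi]; linarith
  · obtain ⟨r, rfl⟩ : ∃ k, r = k + 1 := ⟨r - 1, by omega⟩
    rw [prMap_succ_succ m hi h (by omega) (by omega) (by omega) (by omega)]
    linarith [min_le_left (passage n i A p (r + 1)) (passage n i A (p + 1) r)]

lemma exists_path_sum_eq_passage (hi : 1 ≤ i)
    (h : ∀ p q, 1 ≤ p → p ≤ i → i ≤ q → q ≤ n → 0 ≤ A p q) (k : ℕ) :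
    ∀ p r, 1 ≤ p → p ≤ i → i ≤ r → r ≤ n → k = (i - p) + (n - r) →
      ∃ L : List (ℕ × ℕ), L.head? = some (p, r) ∧ L.getLast? = some (i, n) ∧
        L.IsChain (fun β γ => γ = (β.1, β.2 + 1) ∨ γ = (β.1 + 1, β.2)) ∧
        (L.map fun β => A β.1 β.2).sum = passage n i A p r := by
  induction k with
  | zero =>
    intro p r hp hpi hr hrn hk
    obtain rfl : p = i := by omega
    obtain rfl : r = n := by omega
    exact ⟨[(p, r)], rfl, rfl, List.isChain_singleton _,
      by simp [passage_last le_rfl, passage_end]⟩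
  | succ k ih =>
    intro p r hp hpi hr hrn hk
    have extend : ∀ p' r', 1 ≤ p' → p' ≤ i → i ≤ r' → r' ≤ n → k = (i - p') + (n - r') →
        ((p', r') = (p, r + 1) ∨ (p', r') = (p + 1, r)) →
        passage n i A p r = A p r + passage n i A p' r' →
        ∃ L : List (ℕ × ℕ), L.head? = some (p, r) ∧ L.getLast? = some (i, n) ∧
          L.IsChain (fun β γ => γ = (β.1, β.2 + 1) ∨ γ = (β.1 + 1, β.2)) ∧
          (L.map fun β => A β.1 β.2).sum = passage n i A p r := by
      intro p' r' h1 h2 h3 h4 h5 hstep hval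
      obtain ⟨L, hL1, hL2, hL3, hL4⟩ := ih p' r' h1 h2 h3 h4 h5
      cases L with
      | nil => simp at hL1
      | cons x L =>
        obtain rfl : x = (p', r') := by simpa using hL1
        refine ⟨(p, r) :: (p', r') :: L, rfl, ?_, ?_, ?_⟩
        · rw [List.getLast?_cons_cons]; exact hL2
        · exact List.isChain_cons_cons.2 ⟨hstep, hL3⟩
        · rw [List.map_cons, List.sum_cons, hL4, hval]
    rcases hpi.eq_or_lt with rfl | hpi
    · exact extend p (r + 1) hp le_rfl (by omega) (by omega) (by omega) (Or.inl rfl)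
        (passage_last hrn)
    · have hstep := passage_step hi h hp hpi hr hrn
      rcases le_total (passage n i A p (r + 1)) (passage n i A (p + 1) r) with hle | hle
      · rw [max_eq_right hle] at hstep
        exact extend (p + 1) r (by omega) hpi hr hrn (by omega) (Or.inr rfl) hstep
      · rcases hrn.eq_or_lt with rfl | hrn
        · rw [passage_end] at hle
          rw [max_eq_right (by
            rw [passage_end]; exact passage_nonneg hi h (by omega) hr)] at hstep
          exact extend (p + 1) r (by omega) hpi hr le_rfl (by omega) (Or.inr rfl) hstep
        · rw [max_eq_left hle] at hstep
          exact extend p (r + 1) hp hpi.le (by omega) hrn (by omega) (Or.inl rfl) hstep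

lemma passage_corner_le {m : ℕ} (hi : 1 ≤ i) (hin : i ≤ n) (hA : InB n i m A) :
    passage n i A 1 i ≤ m := by
  obtain ⟨L, h1, h2, h3, h4⟩ :=
    exists_path_sum_eq_passage hi hA.1 _ 1 i le_rfl hi le_rfl hin rfl
  rw [← h4]
  exact hA.2.2 L ⟨by rintro rfl; simp at h1, h1, h2, h3⟩

lemma prMap_path_sum_le (m : ℕ) (hi : 1 ≤ i)
    (h : ∀ p q, 1 ≤ p → p ≤ i → i ≤ q → q ≤ n → 0 ≤ A p q) (L : List (ℕ × ℕ)) :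
    ∀ p r, 1 ≤ p → i ≤ r →
      ((p, r) :: L).IsChain (fun β γ => γ = (β.1, β.2 + 1) ∨ γ = (β.1 + 1, β.2)) →
      ((p, r) :: L).getLast? = some (i, n) →
      p ≤ i ∧ r ≤ n ∧ (((p, r) :: L).map fun β => prMap n i m A β.1 β.2).sum ≤
        prMap n i m A p r + passage n i A p r := by
  induction L with
  | nil =>
    intro p r hp hr hc hl
    obtain ⟨rfl, rfl⟩ : p = i ∧ r = n := by simpa using hl
    refine ⟨le_rfl, le_rfl, ?_⟩
    have := passage_nonneg (n := r) hi h hp hr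
    simpa using this
  | cons x L ih =>
    intro p r hp hr hc hl
    obtain ⟨hx, hc⟩ := List.isChain_cons_cons.1 hc
    rw [List.getLast?_cons_cons] at hl
    rw [List.map_cons, List.sum_cons]
    rcases hx with rfl | rfl
    · obtain ⟨h1, h2, h3⟩ := ih p (r + 1) hp (by omega) hc hl
      have := prMap_add_passage_le_up m hi h hp h1 hr (by omega)
      exact ⟨h1, by omega, by simp only at h3 ⊢; linarith⟩
    · obtain ⟨h1, h2, h3⟩ := ih (p + 1) r (by omega) hr hc hl
      have := prMap_add_passage_le_left m hi h hp (by omega) hr h2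
      exact ⟨by omega, h2, by simp only at h3 ⊢; linarith⟩

lemma prMap_nonneg {m : ℕ} (hi : 1 ≤ i) (hin : i ≤ n) (hA : InB n i m A) {p r : ℕ}
    (hp : 1 ≤ p) (hpi : p ≤ i) (hr : i ≤ r) (hrn : r ≤ n) : 0 ≤ prMap n i m A p r := by
  have h := hA.1
  have down : ∀ p r, 1 ≤ p → p ≤ i → i ≤ r → r ≤ n →
      passage n i A p (r + 1) ≤ passage n i A p r := fun p r h1 h2 h3 h4 => by
    linarith [passage_le_down hi h h1 h2 h3 h4, h p r h1 h2 h3 h4]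
  have right : ∀ p r, 1 ≤ p → p < i → i ≤ r → r ≤ n →
      passage n i A (p + 1) r ≤ passage n i A p r := fun p r h1 h2 h3 h4 => by
    linarith [passage_le_right hi h h1 h2 h3 h4, h p r h1 h2.le h3 h4]
  rcases hp.eq_or_lt with rfl | hp <;> rcases hr.eq_or_lt with rfl | hr
  · rw [prMap_corner m hi h hin]
    linarith [passage_corner_le hi hin hA]
  · obtain ⟨r, rfl⟩ : ∃ k, r = k + 1 := ⟨r - 1, by omega⟩
    rw [prMap_one_succ m hi h (by omega) hrn]
    linarith [down 1 r le_rfl hpi (by omega) (by omega)]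
  · obtain ⟨p, rfl⟩ : ∃ k, p = k + 1 := ⟨p - 1, by omega⟩
    rw [prMap_succ_top m hi h hin (by omega) hpi]
    linarith [right p i (by omega) hpi le_rfl hin]
  · obtain ⟨p, rfl⟩ : ∃ k, p = k + 1 := ⟨p - 1, by omega⟩
    obtain ⟨r, rfl⟩ : ∃ k, r = k + 1 := ⟨r - 1, by omega⟩
    rw [prMap_succ_succ m hi h (by omega) hpi (by omega) hrn, sub_nonneg]
    exact le_min (right p (r + 1) (by omega) hpi (by omega) hrn)
      (down (p + 1) r (by omega) hpi (by omega) (by omega))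

lemma prMap_inB {m : ℕ} (hi : 1 ≤ i) (hin : i ≤ n) (hA : InB n i m A) :
    InB n i m (prMap n i m A) := by
  refine ⟨fun p r hp hpi hr hrn => prMap_nonneg hi hin hA hp hpi hr hrn,
    fun p r hpr => by rw [prMap, if_neg hpr], ?_⟩
  rintro L ⟨hne, hhead, hlast, hchain⟩
  cases L with
  | nil => exact absurd rfl hne
  | cons x L =>
    obtain rfl : x = (1, i) := by simpa using hhead
    have := (prMap_path_sum_le m hi hA.1 L 1 i le_rfl le_rfl hchain hlast).2.2
    rw [prMap_corner m hi hA.1 hin] at this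
    linarith

lemma passage_eq_of_prMap_eq {A' : Arr} {m : ℕ} (hi : 1 ≤ i) (hin : i ≤ n)
    (h : ∀ p q, 1 ≤ p → p ≤ i → i ≤ q → q ≤ n → 0 ≤ A p q)
    (h' : ∀ p q, 1 ≤ p → p ≤ i → i ≤ q → q ≤ n → 0 ≤ A' p q)
    (he : prMap n i m A = prMap n i m A') {p : ℕ} (hp : 1 ≤ p) (hpi : p ≤ i) {r : ℕ}
    (hr : i ≤ r) (hrn : r ≤ n) : passage n i A p r = passage n i A' p r := by
  have he' : ∀ p r, prMap n i m A p r = prMap n i m A' p r := fun p r => by rw [he]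
  induction p, hp using Nat.le_induction generalizing r with
  | base =>
    induction r, hr using Nat.le_induction with
    | base =>
      have := he' 1 i
      rw [prMap_corner m hi h hin, prMap_corner m hi h' hin] at this
      linarith
    | succ r hr ih =>
      have := he' 1 (r + 1)
      rw [prMap_one_succ m hi h hr hrn, prMap_one_succ m hi h' hr hrn, ih (by omega)] at this
      linarith
  | succ p hp ihp =>
    induction r, hr using Nat.le_induction with
    | base =>
      have := he' (p + 1) i
      rw [prMap_succ_top m hi h hin hp hpi, prMap_succ_top m hi h' hin hp hpi,
        ihp (by omega) le_rfl hin] at this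
      linarith
    | succ r hr ih =>
      have := he' (p + 1) (r + 1)
      rw [prMap_succ_succ m hi h hp hpi hr hrn, prMap_succ_succ m hi h' hp hpi hr hrn,
        ihp (by omega) (by omega) hrn, ih (by omega)] at this
      linarith

lemma prMap_injOn {m : ℕ} (hi : 1 ≤ i) (hin : i ≤ n) :
    Set.InjOn (prMap n i m) {A : Arr | InB n i m A} := by
  intro A hA A' hA' he
  have key : ∀ p r, 1 ≤ p → p ≤ i → i ≤ r → r ≤ n + 1 →
      passage n i A p r = passage n i A' p r := by
    intro p r hp hpi hr hrn
    rcases hrn.eq_or_lt with rfl | hrn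
    · rw [passage_end, passage_end]
    · exact passage_eq_of_prMap_eq hi hin hA.1 hA'.1 he hp hpi hr (by omega)
  funext p r
  by_cases hb : 1 ≤ p ∧ p ≤ i ∧ i ≤ r ∧ r ≤ n
  · obtain ⟨hp, hpi, hr, hrn⟩ := hb
    have h1 := key p r hp hpi hr (by omega)
    have h2 := key p (r + 1) hp hpi (by omega) (by omega)
    rcases hpi.eq_or_lt with rfl | hpi
    · rw [passage_last hrn, passage_last hrn, h2] at h1
      linarith
    · rw [passage_step hi hA.1 hp hpi hr hrn, passage_step hi hA'.1 hp hpi hr hrn, h2,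
        key (p + 1) r (by omega) hpi hr (by omega)] at h1
      linarith
  · rw [hA.2.1 p r hb, hA'.2.1 p r hb]

lemma entry_le {m : ℕ} (hi : 1 ≤ i) (hin : i ≤ n) (hA : InB n i m A) {p r : ℕ}
    (hp : 1 ≤ p) (hpi : p ≤ i) (hr : i ≤ r) (hrn : r ≤ n) : A p r ≤ m := by
  have h := hA.1
  have h1 : passage n i A p r ≤ passage n i A p i := by
    induction r, hr using Nat.le_induction with
    | base => rfl
    | succ r hr ih =>
      linarith [ih (by omega), passage_le_down hi h hp hpi hr (by omega),
        h p r hp hpi hr (by omega)]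
  have h2 : passage n i A p i ≤ passage n i A 1 i := by
    clear h1
    induction p, hp using Nat.le_induction with
    | base => rfl
    | succ p hp ih =>
      linarith [ih (by omega), passage_le_right hi h hp hpi le_rfl hin,
        h p i hp (by omega) le_rfl hin]
  linarith [passage_le_down hi h hp hpi hr hrn, passage_corner_le hi hin hA,
    passage_nonneg (n := n) (r := r + 1) hi h hp (by omega)]

end passage

lemma finite_inB {n i m : ℕ} (hi : 1 ≤ i) (hin : i ≤ n) : {A : Arr | InB n i m A}.Finite := by
  let restr : Arr → (Icc 1 i → Icc i n → ℤ) := fun A p r => A p r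
  refine Set.Finite.of_finite_image (f := restr) ?_ ?_
  · refine (Set.Finite.pi' (t := fun _ => {f | ∀ r, f r ∈ Set.Icc (0 : ℤ) m}) fun _ =>
      Set.Finite.pi' fun _ => Set.finite_Icc _ _).subset ?_
    rintro _ ⟨A, hA, rfl⟩ p r
    have hp := mem_Icc.1 p.2
    have hr := mem_Icc.1 r.2
    exact ⟨hA.1 p r hp.1 hp.2 hr.1 hr.2, entry_le hi hin hA hp.1 hp.2 hr.1 hr.2⟩
  · intro A hA A' hA' he
    funext p r
    by_cases hb : 1 ≤ p ∧ p ≤ i ∧ i ≤ r ∧ r ≤ n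
    · exact congrFun (congrFun he ⟨p, mem_Icc.2 ⟨hb.1, hb.2.1⟩⟩) ⟨r, mem_Icc.2 hb.2.2⟩
    · rw [hA.2.1 p r hb, hA'.2.1 p r hb]

/-- The promotion map is a well-defined bijection of `B^{m,i}`. -/
theorem stmt17 (n i m : ℕ) (hi : 2 ≤ i) (hin : i ≤ n) :
    (∀ A : Arr, InB n i m A → InB n i m (prMap n i m A)) ∧
    Set.BijOn (prMap n i m) {A : Arr | InB n i m A} {A : Arr | InB n i m A} := by
  have hi' : 1 ≤ i := by omega
  have hmaps : ∀ A : Arr, InB n i m A → InB n i m (prMap n i m A) :=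
    fun A hA => prMap_inB hi' hin hA
  exact ⟨hmaps, ((finite_inB hi' hin).injOn_iff_bijOn_of_mapsTo hmaps).1 (prMap_injOn hi' hin)⟩

end KR
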